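/- Let R_n be the sprout sequence with seed F(t). Then ∑_{n≥0} ([s_{1^n}] R_n) t^n = 1/F(−t), where s_{1^n} = e_n is the Schur function of the one-column partition. -/

import Mathlib

/- Symmetric functions in infinitely many variables `x₁, x₂, …` are modelled as
elements of `MvPowerSeries ℕ K`. A sprout sequence with seed
`F(t) = ∑ aₙ tⁿ` (`a₀ = 1`) is defined by `∑ₙ Rₙ tⁿ = ∏ᵢ F(xᵢ t)`; since `Rₙ` is
homogeneous of degree `n`, the variable `t` is recorded by the total degree, and
the product `∏ᵢ F(xᵢ t)` is the power series whose coefficient on the monomial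
`∏ᵢ xᵢ^{dᵢ}` is `∏ᵢ a_{dᵢ}`. -/

open Finset

noncomputable section

variable {K : Type*} [Field K] [CharZero K]

/-- Total degree of a monomial exponent vector. -/
def mdeg (d : ℕ →₀ ℕ) : ℕ := d.sum fun _ k => k

/-- The infinite product `∏_{i≥1} F(x_i t)` where `F(t) = ∑ aₙ tⁿ`: the
coefficient of `∏ xᵢ^{dᵢ}` is `∏ a_{dᵢ}`. -/
def sproutSeries (a : ℕ → K) : MvPowerSeries ℕ K :=
  fun d => d.prod fun _ k => a k

/-- `sproutFn a n` is `Rₙ`, the degree-`n` homogeneous component of `∏ᵢ F(xᵢ t)`,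
so that `∑ₙ (sproutFn a n) tⁿ = ∏ᵢ F(xᵢ t)`. -/
def sproutFn (a : ℕ → K) (n : ℕ) : MvPowerSeries ℕ K :=
  fun d => if mdeg d = n then sproutSeries a d else 0

/-- The multiset of nonzero exponents of a monomial. -/
def typeOf (d : ℕ →₀ ℕ) : Multiset ℕ := d.support.val.map d

/-- The monomial symmetric function `m_μ` (in infinitely many variables). -/
def msym (K : Type*) [Field K] (μ : Multiset ℕ) : MvPowerSeries ℕ K :=
  fun d => if typeOf d = μ then 1 else 0

/-- The power sum symmetric function `p_k`. -/
def psym (K : Type*) [Field K] (k : ℕ) : MvPowerSeries ℕ K := msym K {k}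

/-- `p_μ = p_{μ₁} p_{μ₂} ⋯`. -/
def pprod (K : Type*) [Field K] (μ : Multiset ℕ) : MvPowerSeries ℕ K :=
  (μ.map (psym K)).prod

/-- The complete homogeneous symmetric function `h_n`. -/
def hsym (K : Type*) [Field K] (n : ℕ) : MvPowerSeries ℕ K :=
  fun d => if mdeg d = n then 1 else 0

/-- `h_μ = h_{μ₁} h_{μ₂} ⋯`. -/
def hprod (K : Type*) [Field K] (μ : Multiset ℕ) : MvPowerSeries ℕ K :=
  (μ.map (hsym K)).prod

/-- The elementary symmetric function `e_n`. -/
def esym (K : Type*) [Field K] (n : ℕ) : MvPowerSeries ℕ K :=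
  msym K (Multiset.replicate n 1)

/-- `e_μ = e_{μ₁} e_{μ₂} ⋯`. -/
def eprod (K : Type*) [Field K] (μ : Multiset ℕ) : MvPowerSeries ℕ K :=
  (μ.map (esym K)).prod

/-- `z_λ = ∏ᵢ i^{mᵢ} mᵢ!` where `λ` has `mᵢ` parts equal to `i`. -/
def zPart (μ : Multiset ℕ) : ℕ :=
  μ.prod * (μ.dedup.map fun i => (μ.count i).factorial).prod

/-- The parts of a partition arranged in weakly decreasing order. -/
def plist (μ : Multiset ℕ) : List ℕ := (μ.sort (· ≤ ·)).reverse

/-- `h_m` for an integer index, with `h_m = 0` for `m < 0`. -/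
def hsymZ (K : Type*) [Field K] (m : ℤ) : MvPowerSeries ℕ K :=
  if 0 ≤ m then hsym K m.toNat else 0

/-- The Schur function `s_λ`, via the Jacobi–Trudi determinant `det[h_{λᵢ-i+j}]`,
where `l` is the weakly decreasing list of parts of `λ`. -/
def sschur (K : Type*) [Field K] (l : List ℕ) : MvPowerSeries ℕ K :=
  Matrix.det (Matrix.of fun i j : Fin l.length =>
    hsymZ K ((l.get i : ℤ) - (i : ℤ) + (j : ℤ)))

/-- `a_m` for an integer index, with `a_m = 0` for `m < 0`. -/
def aZ (a : ℕ → K) (m : ℤ) : K := if 0 ≤ m then a m.toNat else 0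

/-- The partition `⟨1ⁿ⟩` of `n`. -/
def onePartition (n : ℕ) : Nat.Partition n :=
  ⟨Multiset.replicate n 1, by
    intro i hi
    rw [Multiset.eq_of_mem_replicate hi]
    exact Nat.one_pos, by simp [Multiset.sum_replicate]⟩

/-- The ring homomorphism setting `xᵢ = t` for `i ∈ s` and `xᵢ = 0` for `i ∉ s`. -/
def principalSpec (L : Type*) [Field L] (s : Finset ℕ) : MvPowerSeries ℕ L →+* PowerSeries L where
  toFun f := PowerSeries.mk fun n => ∑ d ∈ finsuppAntidiag s n, MvPowerSeries.coeff d f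
  map_one' := by
    classical
    ext n
    simp only [PowerSeries.coeff_mk, MvPowerSeries.coeff_one, PowerSeries.coeff_one]
    rw [Finset.sum_ite_eq']
    simp [eq_comm]
  map_zero' := by ext n; simp
  map_add' f g := by ext n; simp [Finset.sum_add_distrib]
  map_mul' f g := by
    classical
    ext n
    simp only [PowerSeries.coeff_mk, PowerSeries.coeff_mul, MvPowerSeries.coeff_mul,
      Finset.sum_mul_sum]
    simp_rw [← Finset.sum_product', Finset.sum_sigma']
    refine Finset.sum_bij' (fun x _ => ⟨(s.sum x.2.1, s.sum x.2.2), x.2⟩)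
      (fun x _ => ⟨x.2.1 + x.2.2, x.2⟩) ?_ ?_ ?_ ?_ ?_
    · rintro ⟨d, p, q⟩ h
      simp only [mem_sigma, mem_finsuppAntidiag, HasAntidiagonal.mem_antidiagonal,
        mem_product] at h ⊢
      obtain ⟨⟨hsum, hsupp⟩, rfl⟩ := h
      refine ⟨by simpa [Finset.sum_add_distrib] using hsum, ⟨trivial, ?_⟩, trivial, ?_⟩
      · exact (Finsupp.support_mono le_self_add).trans hsupp
      · exact (Finsupp.support_mono le_add_self).trans hsupp
    · rintro ⟨⟨i, j⟩, p, q⟩ h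
      simp only [mem_sigma, mem_finsuppAntidiag, HasAntidiagonal.mem_antidiagonal,
        mem_product] at h ⊢
      obtain ⟨hij, ⟨hp, hps⟩, hq, hqs⟩ := h
      refine ⟨⟨?_, Finsupp.support_add.trans (Finset.union_subset hps hqs)⟩, trivial⟩
      simp [Finset.sum_add_distrib, hp, hq, hij]
    · rintro ⟨d, p, q⟩ h
      simp only [mem_sigma, HasAntidiagonal.mem_antidiagonal] at h
      simp [h.2]
    · rintro ⟨⟨i, j⟩, p, q⟩ h
      simp only [mem_sigma, mem_finsuppAntidiag, mem_product] at h
      simp [h.2.1.1, h.2.2.1]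
    · intros; rfl

theorem coeff_principalSpec {L : Type*} [Field L] (s : Finset ℕ) (f : MvPowerSeries ℕ L) (n : ℕ) :
    PowerSeries.coeff n (principalSpec L s f) =
      ∑ d ∈ finsuppAntidiag s n, MvPowerSeries.coeff d f :=
  PowerSeries.coeff_mk n fun n => ∑ d ∈ finsuppAntidiag s n, MvPowerSeries.coeff d f

theorem mdeg_of_mem_finsuppAntidiag {s : Finset ℕ} {n : ℕ} {d : ℕ →₀ ℕ}
    (hd : d ∈ finsuppAntidiag s n) : mdeg d = n :=
  (mem_finsuppAntidiag'.1 hd).1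

theorem principalSpec_sproutFn {L : Type*} [Field L] (a : ℕ → L) (ha0 : a 0 = 1)
    (s : Finset ℕ) (n : ℕ) :
    principalSpec L s (sproutFn a n) =
      PowerSeries.monomial n (PowerSeries.coeff n (PowerSeries.mk a ^ #s)) := by
  classical
  ext m
  rw [coeff_principalSpec, PowerSeries.coeff_monomial]
  have key : ∀ d ∈ finsuppAntidiag s m,
      MvPowerSeries.coeff d (sproutFn a n) = if m = n then ∏ i ∈ s, a (d i) else 0 := by
    intro d hd
    change (if mdeg d = n then d.prod fun _ k => a k else 0) = _
    rw [mdeg_of_mem_finsuppAntidiag hd,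
      Finsupp.prod_of_support_subset _ (mem_finsuppAntidiag.1 hd).2 _ fun _ _ => ha0]
  rw [Finset.sum_congr rfl key]
  split_ifs with h
  · subst h
    rw [← Finset.prod_const, PowerSeries.coeff_prod]
    simp
  · simp

theorem hsym_eq_sproutFn (L : Type*) [Field L] (n : ℕ) :
    hsym L n = sproutFn (fun _ => (1 : L)) n := by
  funext d
  simp [hsym, sproutFn, sproutSeries, Finsupp.prod]

/-- The polynomial in `N` interpolating the coefficient of `tⁿ` in `F(t)^N`. -/
def powCoeffPoly (a : ℕ → K) (n : ℕ) : Polynomial K :=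
  ∑ k ∈ Finset.range (n + 1),
    Polynomial.C (PowerSeries.coeff n ((PowerSeries.mk a - 1) ^ k) / (k.factorial : K)) *
      descPochhammer K k

theorem eval_powCoeffPoly (a : ℕ → K) (ha0 : a 0 = 1) (n N : ℕ) :
    (powCoeffPoly a n).eval (N : K) = PowerSeries.coeff n (PowerSeries.mk a ^ N) := by
  set G : PowerSeries K := PowerSeries.mk a - 1 with hG
  have hX : PowerSeries.X ∣ G := by
    rw [PowerSeries.X_dvd_iff, ← PowerSeries.coeff_zero_eq_constantCoeff_apply, hG, map_sub,
      PowerSeries.coeff_mk, PowerSeries.coeff_zero_one, ha0, sub_self]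
  have hlow : ∀ k, n < k → PowerSeries.coeff n (G ^ k) = 0 := fun k hk =>
    PowerSeries.X_pow_dvd_iff.1 (pow_dvd_pow_of_dvd hX k) n hk
  have hF : PowerSeries.mk a = G + 1 := by simp [hG]
  have hleft : (powCoeffPoly a n).eval (N : K) =
      ∑ k ∈ Finset.range (n + 1), PowerSeries.coeff n (G ^ k) * (N.choose k : K) := by
    rw [powCoeffPoly, Polynomial.eval_finsetSum]
    refine Finset.sum_congr rfl fun k _ => ?_
    rw [Polynomial.eval_mul, Polynomial.eval_C, Nat.cast_choose_eq_descPochhammer_div K N k]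
    ring
  have hright : PowerSeries.coeff n (PowerSeries.mk a ^ N) =
      ∑ k ∈ Finset.range (N + 1), PowerSeries.coeff n (G ^ k) * (N.choose k : K) := by
    rw [hF, add_pow, map_sum]
    refine Finset.sum_congr rfl fun k _ => ?_
    rw [one_pow, mul_one, ← nsmul_eq_mul', map_nsmul, nsmul_eq_mul']
  rw [hleft, hright]
  have hextend : ∀ m, (∀ k, m < k → PowerSeries.coeff n (G ^ k) * (N.choose k : K) = 0) →
      m ≤ n + N → ∑ k ∈ Finset.range (m + 1), PowerSeries.coeff n (G ^ k) * (N.choose k : K) =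
        ∑ k ∈ Finset.range (n + N + 1), PowerSeries.coeff n (G ^ k) * (N.choose k : K) := by
    intro m hm hle
    refine Finset.sum_subset (Finset.range_mono (by omega)) fun k _ hk => hm k ?_
    simpa using hk
  rw [hextend n (fun k hk => by rw [hlow k hk, zero_mul]) (by omega),
    hextend N (fun k hk => by rw [Nat.choose_eq_zero_of_lt hk, Nat.cast_zero, mul_zero]) (by omega)]

theorem Polynomial.eq_of_eval_natCast_eq {p q : Polynomial K}
    (h : ∀ N : ℕ, p.eval (N : K) = q.eval (N : K)) : p = q := by
  refine Polynomial.eq_of_infinite_eval_eq p q ?_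
  refine (Set.infinite_range_of_injective (Nat.cast_injective (R := K))).mono ?_
  rintro _ ⟨N, rfl⟩
  exact h N

/-- The values at `-1` are the coefficients of `1 / F(t)`. -/
theorem sum_mul_eval_neg_one_powCoeffPoly (a : ℕ → K) (ha0 : a 0 = 1) (n : ℕ) :
    ∑ k ∈ Finset.range (n + 1), a (n - k) * (powCoeffPoly a k).eval (-1) =
      if n = 0 then 1 else 0 := by
  have hpoly : ∑ k ∈ Finset.range (n + 1), Polynomial.C (a (n - k)) * powCoeffPoly a k =
      (powCoeffPoly a n).comp (Polynomial.X + 1) := by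
    refine Polynomial.eq_of_eval_natCast_eq fun N => ?_
    have hcast : (N : K) + 1 = ((N + 1 : ℕ) : K) := by push_cast; rfl
    simp only [Polynomial.eval_finsetSum, Polynomial.eval_mul, Polynomial.eval_C,
      Polynomial.eval_comp, Polynomial.eval_add, Polynomial.eval_X, Polynomial.eval_one, hcast,
      eval_powCoeffPoly a ha0]
    rw [pow_succ, PowerSeries.coeff_mul, Finset.Nat.sum_antidiagonal_eq_sum_range_succ_mk]
    exact Finset.sum_congr rfl fun k _ => by rw [PowerSeries.coeff_mk, mul_comm]
  have heval := congrArg (Polynomial.eval (-1)) hpoly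
  have hzero := eval_powCoeffPoly a ha0 n 0
  rw [Nat.cast_zero, pow_zero, PowerSeries.coeff_one] at hzero
  simpa [Polynomial.eval_finsetSum, hzero] using heval

/-- The polynomial in `N` interpolating `h_m(1^N)`, for an integer index `m`. -/
def hPoly (K : Type*) [Field K] [CharZero K] (m : ℤ) : Polynomial K :=
  if 0 ≤ m then powCoeffPoly (fun _ => (1 : K)) m.toNat else 0

theorem principalSpec_hsymZ (N : ℕ) (m : ℤ) :
    principalSpec K (Finset.range N) (hsymZ K m) =
      PowerSeries.monomial m.toNat ((hPoly K m).eval (N : K)) := by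
  unfold hsymZ hPoly
  split_ifs with h
  · rw [hsym_eq_sproutFn, principalSpec_sproutFn _ rfl, eval_powCoeffPoly _ rfl,
      Finset.card_range]
  · simp

theorem coeff_principalSpec_sschur (l : List ℕ) (N : ℕ) :
    PowerSeries.coeff l.sum (principalSpec K (Finset.range N) (sschur K l)) =
      (Matrix.det (Matrix.of fun i j : Fin l.length =>
        hPoly K ((l.get i : ℤ) - (i : ℤ) + (j : ℤ)))).eval (N : K) := by
  rw [sschur, Matrix.det_apply', Matrix.det_apply', map_sum, map_sum, Polynomial.eval_finsetSum]
  refine Finset.sum_congr rfl fun σ _ => ?_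
  simp only [map_mul, map_intCast, map_prod, Matrix.of_apply, principalSpec_hsymZ,
    Polynomial.eval_mul, Polynomial.eval_intCast, Polynomial.eval_prod]
  rw [PowerSeries.prod_monomial, ← zsmul_eq_mul, map_zsmul, zsmul_eq_mul,
    PowerSeries.coeff_monomial]
  congr 1
  rw [ite_eq_left_iff]
  intro hne
  by_contra hprod
  refine hne ?_
  have hnonneg : ∀ i : Fin l.length, 0 ≤ (l.get (σ i) : ℤ) - (σ i : ℤ) + (i : ℤ) := by
    intro i
    by_contra hi
    refine hprod (Finset.prod_eq_zero (Finset.mem_univ i) ?_).symm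
    rw [hPoly, if_neg hi, Polynomial.eval_zero]
  have hsum : l.sum = ∑ i, l.get i := (Fin.sum_univ_getElem l).symm
  rw [hsum]
  zify
  rw [Finset.sum_congr rfl fun i _ => Int.toNat_of_nonneg (hnonneg i), Finset.sum_add_distrib,
    Finset.sum_sub_distrib, Equiv.sum_comp σ (fun i => (l.get i : ℤ)),
    Equiv.sum_comp σ (fun i => ((i : ℕ) : ℤ)), sub_add_cancel]

theorem eval_neg_one_hPoly (m : ℤ) :
    (hPoly K m).eval (-1) = if m = 0 then 1 else if m = 1 then -1 else 0 := by
  have hsum := sum_mul_eval_neg_one_powCoeffPoly (fun _ => (1 : K)) rfl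
  have hsucc : ∀ n, (powCoeffPoly (fun _ => (1 : K)) (n + 1)).eval (-1) =
      if n = 0 then -1 else 0 := by
    intro n
    have h := hsum (n + 1)
    simp only [one_mul] at hsum h
    rw [Finset.sum_range_succ, hsum n, if_neg n.succ_ne_zero] at h
    rw [eq_neg_of_add_eq_zero_right h]
    split_ifs <;> simp
  unfold hPoly
  rcases lt_or_ge m 0 with hm | hm
  · rw [if_neg (by omega), if_neg (by omega), if_neg (by omega), Polynomial.eval_zero]
  · lift m to ℕ using hm
    rw [if_pos (Int.natCast_nonneg m), Int.toNat_natCast]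
    rcases m with _ | n
    · simpa using hsum 0
    · rw [hsucc n]
      norm_cast
      simp

theorem length_plist (μ : Multiset ℕ) : (plist μ).length = μ.card := by
  simp [plist]

theorem mem_plist {μ : Multiset ℕ} {x : ℕ} : x ∈ plist μ ↔ x ∈ μ := by
  simp [plist]

theorem sum_plist (μ : Multiset ℕ) : (plist μ).sum = μ.sum := by
  rw [plist, List.sum_reverse, ← Multiset.sum_coe, Multiset.sort_eq]

theorem pairwise_plist (μ : Multiset ℕ) : (plist μ).Pairwise (· ≥ ·) := by
  rw [plist, List.pairwise_reverse]
  exact μ.pairwise_sort (· ≤ ·)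

theorem det_hPoly_eval_neg_one_of_two_le {l : List ℕ} (hl : l.Pairwise (· ≥ ·)) {x : ℕ}
    (hx : x ∈ l) (hx2 : 2 ≤ x) :
    (Matrix.det (Matrix.of fun i j : Fin l.length =>
      hPoly K ((l.get i : ℤ) - (i : ℤ) + (j : ℤ)))).eval (-1) = 0 := by
  rcases l with _ | ⟨y, l⟩
  · simp at hx
  have hy : 2 ≤ y := by
    rcases List.mem_cons.1 hx with rfl | hx
    · exact hx2
    · exact hx2.trans ((List.pairwise_cons.1 hl).1 x hx)
  rw [← Polynomial.coe_evalRingHom, RingHom.map_det]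
  refine Matrix.det_eq_zero_of_row_eq_zero ⟨0, by simp⟩ fun j => ?_
  simp only [RingHom.mapMatrix_apply, Matrix.map_apply, Matrix.of_apply,
    Polynomial.coe_evalRingHom, eval_neg_one_hPoly, List.get_eq_getElem, List.getElem_cons_zero]
  rw [if_neg (by omega), if_neg (by omega)]

theorem det_hPoly_eval_neg_one_of_forall_eq_one {l : List ℕ} (hl : ∀ x ∈ l, x = 1) :
    (Matrix.det (Matrix.of fun i j : Fin l.length =>
      hPoly K ((l.get i : ℤ) - (i : ℤ) + (j : ℤ)))).eval (-1) = (-1) ^ l.length := by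
  have hget : ∀ i, l.get i = 1 := fun i => hl _ (l.get_mem i)
  rw [← Polynomial.coe_evalRingHom, RingHom.map_det, Matrix.det_of_isLowerTriangular]
  · simp [hget, eval_neg_one_hPoly, -List.get_eq_getElem]
  · intro i j hij
    have hij : (i : ℕ) < (j : ℕ) := hij
    simp only [RingHom.mapMatrix_apply, Matrix.map_apply, Matrix.of_apply,
      Polynomial.coe_evalRingHom, eval_neg_one_hPoly, hget]
    rw [if_neg (by omega), if_neg (by omega)]

theorem exists_two_le_of_ne_onePartition {n : ℕ} {l : Nat.Partition n} (h : l ≠ onePartition n) :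
    ∃ x ∈ l.parts, 2 ≤ x := by
  by_contra! hlt
  refine h (Nat.Partition.ext ?_)
  have hrep : l.parts = Multiset.replicate l.parts.card 1 :=
    Multiset.eq_replicate_card.2 fun x hx => by
      have := l.parts_pos hx
      have := hlt x hx
      omega
  have hcard : l.parts.card = n := by
    have := l.parts_sum
    rw [hrep] at this
    simpa using this
  rw [hrep, hcard]
  rfl

theorem eval_neg_one_powCoeffPoly_eq (a : ℕ → K) (ha0 : a 0 = 1) (n : ℕ)
    (c : Nat.Partition n → K)
    (hc : sproutFn a n = ∑ l : Nat.Partition n, c l • sschur K (plist l.parts)) :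
    (powCoeffPoly a n).eval (-1) = (-1) ^ n * c (onePartition n) := by
  have hpoly : powCoeffPoly a n = ∑ l : Nat.Partition n, Polynomial.C (c l) *
      Matrix.det (Matrix.of fun i j : Fin (plist l.parts).length =>
        hPoly K (((plist l.parts).get i : ℤ) - (i : ℤ) + (j : ℤ))) := by
    refine Polynomial.eq_of_eval_natCast_eq fun N => ?_
    have hN := congrArg (PowerSeries.coeff n ∘ principalSpec K (Finset.range N)) hc
    simp only [Function.comp_apply, principalSpec_sproutFn a ha0, PowerSeries.coeff_monomial_same,
      Finset.card_range] at hN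
    rw [eval_powCoeffPoly a ha0, hN, map_sum, map_sum, Polynomial.eval_finsetSum]
    refine Finset.sum_congr rfl fun l _ => ?_
    rw [Polynomial.eval_mul, Polynomial.eval_C, ← coeff_principalSpec_sschur, sum_plist,
      l.parts_sum]
    simp only [coeff_principalSpec, map_smul, smul_eq_mul, Finset.mul_sum]
  rw [hpoly, Polynomial.eval_finsetSum, Finset.sum_eq_single (onePartition n)]
  · rw [Polynomial.eval_mul, Polynomial.eval_C, det_hPoly_eval_neg_one_of_forall_eq_one,
      length_plist, mul_comm]
    · simp [onePartition]
    · intro x hx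
      exact Multiset.eq_of_mem_replicate (mem_plist.1 hx)
  · intro l _ hl
    obtain ⟨x, hx, hx2⟩ := exists_two_le_of_ne_onePartition hl
    rw [Polynomial.eval_mul,
      det_hPoly_eval_neg_one_of_two_le (pairwise_plist _) (mem_plist.2 hx) hx2, mul_zero]
  · simp

/-- `∑_{n≥0} ([s_{1ⁿ}] Rₙ) tⁿ = 1/F(-t)`, expressed by the
convolution identities: the `n = 0` coefficient is `1` and for `n ≥ 1`,
`∑_{k=0}^n (-1)^{n-k} a_{n-k} · ([s_{1ᵏ}] R_k) = 0` (i.e. the series times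
`F(-t)` equals `1`). -/
theorem statement10 (a : ℕ → K) (ha0 : a 0 = 1)
    (c : ∀ n : ℕ, Nat.Partition n → K)
    (hc : ∀ n : ℕ,
      sproutFn a n = ∑ l : Nat.Partition n, c n l • sschur K (plist l.parts)) :
    c 0 (onePartition 0) = 1 ∧
    ∀ n : ℕ, 1 ≤ n →
      ∑ k ∈ Finset.range (n + 1),
        (-1 : K) ^ (n - k) * a (n - k) * c k (onePartition k) = 0 := by
  have key : ∀ n : ℕ, ∑ k ∈ Finset.range (n + 1),
      (-1 : K) ^ (n - k) * a (n - k) * c k (onePartition k) = if n = 0 then 1 else 0 := by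
    intro n
    have h := congrArg ((-1 : K) ^ n * ·) (sum_mul_eval_neg_one_powCoeffPoly a ha0 n)
    simp only [Finset.mul_sum] at h
    have hsign : (-1 : K) ^ n * (if n = 0 then 1 else 0) = if n = 0 then 1 else 0 := by
      split_ifs with hn <;> simp [hn]
    rw [hsign] at h
    rw [← h]
    refine Finset.sum_congr rfl fun k hk => ?_
    have hkn : k ≤ n := Nat.lt_succ_iff.1 (Finset.mem_range.1 hk)
    have hpow : (-1 : K) ^ n * (-1) ^ k = (-1) ^ (n - k) := by
      rw [← Nat.sub_add_cancel hkn, pow_add, Nat.add_sub_cancel, mul_assoc, ← mul_pow]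
      simp
    rw [eval_neg_one_powCoeffPoly_eq a ha0 k (c k) (hc k), ← hpow]
    ring
  refine ⟨?_, fun n hn => ?_⟩
  · simpa [ha0] using key 0
  · rw [key n, if_neg (by omega)]

end
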